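/- arXiv:1102.2593 — 2 statements merged into one kernel-verified Lean document; each statement's English description precedes it below -/
import Mathlib

section
/- Let q be a prime power and let n ≥ 8 be an integer. Set s = n−4 if n is odd and s = n−3 if n is even, and suppose q² + q + 1 < s. Let α = ⌊(n−3)/(q²+q+2)⌋. Then there exists an (n, M, 4, 3)_q constant dimension code with M = q^{2(n−3)} + ∑_{i=1}^{α} Gauss[q²+q+2, 2]_q · q^{2(n−3−(q²+q+2)i)} which contains an (n,3,2)_q lifted MRD code; in particular A_q(n,4,3) ≥ M. -/
open Module Polynomial Matrix

variable (F : Type) [Field F] [Fintype F]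

/-- `C` is a `[k × (n-k), (n-k)(k-δ+1), δ]_q` MRD (maximum rank distance) code:
an `F`-linear subspace of `k × (n-k)` matrices of dimension `(n-k)(k-δ+1)` in which
every nonzero matrix has rank at least `δ`. -/
def IsMRD (n k δ : ℕ) (C : Submodule F (Matrix (Fin k) (Fin (n - k)) F)) : Prop :=
  Module.finrank F C = (n - k) * (k - δ + 1) ∧
    ∀ A : Matrix (Fin k) (Fin (n - k)) F, A ∈ C → A ≠ 0 → δ ≤ A.rank

/-- The matrix `[I_k | A]`. -/
def liftMatrix (n k : ℕ) (A : Matrix (Fin k) (Fin (n - k)) F) : Matrix (Fin k) (Fin n) F :=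
  Matrix.of fun i j =>
    if h : (j : ℕ) < k then (if (i : ℕ) = (j : ℕ) then 1 else 0)
    else A i ⟨(j : ℕ) - k, by have := j.isLt; omega⟩

/-- The lifting of the matrix `A`: the row space of `[I_k | A]`, a subspace of `F^n`. -/
def liftSubspace (n k : ℕ) (A : Matrix (Fin k) (Fin (n - k)) F) : Submodule F (Fin n → F) :=
  Submodule.span F (Set.range fun i => liftMatrix F n k A i)

/-- The lifted code of a rank-metric code `C`: the set of liftings of all codewords of `C`. -/
def liftedCode (n k : ℕ) (C : Submodule F (Matrix (Fin k) (Fin (n - k)) F)) :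
    Set (Submodule F (Fin n → F)) :=
  {X | ∃ A ∈ C, X = liftSubspace F n k A}

/-- The subspace distance `d_S(X,Y) = dim X + dim Y - 2 dim (X ⊓ Y)`. -/
noncomputable def subDist {n : ℕ} (X Y : Submodule F (Fin n → F)) : ℕ :=
  finrank F X + finrank F Y - 2 * finrank F (X ⊓ Y : Submodule F (Fin n → F))

/-- `L^{(n,k)}`: vectors of `F^n` whose first `k` coordinates are not all zero. -/
def Lset (n k : ℕ) : Set (Fin n → F) := {v | ∃ i : Fin n, (i : ℕ) < k ∧ v i ≠ 0}

/-- `V^n`: one-dimensional subspaces of `F^n` spanned by vectors of `L^{(n,k)}`. -/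
def Vset (n k : ℕ) : Set (Submodule F (Fin n → F)) :=
  {X | ∃ v ∈ Lset F n k, X = Submodule.span F {v}}

/-- Projection of a vector of `F^n` onto its first `k` coordinates. -/
def projK (n k : ℕ) (v : Fin n → F) : Fin k → F :=
  fun i => if h : (i : ℕ) < n then v ⟨(i : ℕ), h⟩ else 0

/-- `V_A^{(n,k)}`: one-dimensional subspaces of `F^n` spanned by vectors whose projection
onto the first `k` coordinates is a nonzero vector spanning `A`. -/
def VA (n k : ℕ) (A : Submodule F (Fin k → F)) : Set (Submodule F (Fin n → F)) :=
  {X | ∃ v : Fin n → F, projK F n k v ≠ 0 ∧ Submodule.span F {projK F n k v} = A ∧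
    X = Submodule.span F {v}}

/-- `A_q(n,d,k)`: the maximum size of an `(n, M, d, k)_q` constant dimension code, i.e. of a
set of `k`-dimensional subspaces of `F^n` whose pairwise subspace distances are at least `d`. -/
noncomputable def Aq (n d k : ℕ) : ℕ :=
  sSup {M | ∃ S : Set (Submodule F (Fin n → F)), S.Finite ∧ S.ncard = M ∧
    (∀ X ∈ S, finrank F X = k) ∧ ∀ X ∈ S, ∀ Y ∈ S, X ≠ Y → d ≤ subDist F X Y}

/-- The Gaussian coefficient `[n, k]_q`: the number of `k`-dimensional subspaces of `F^n`. -/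
noncomputable def gaussNat (n k : ℕ) : ℕ :=
  Nat.card {X : Submodule F (Fin n → F) // finrank F X = k}

theorem exists_pencil_without_eigenvector {K V : Type} [Field K] [Finite K] [AddCommGroup V]
    [Module K V] [FiniteDimensional K V] (hV : 3 ≤ finrank K V) :
    ∃ f g : V →ₗ[K] V, ∀ (z : V) (a b c : K), a • f z + b • g z = c • z →
      z = 0 ∨ (a = 0 ∧ b = 0) := by
  obtain ⟨p, hp⟩ := CharP.exists K
  have : Fact p.Prime := ⟨(CharP.char_is_prime_or_zero K p).resolve_right
    (CharP.char_ne_zero_of_finite K p)⟩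
  have : NeZero (finrank K V) := ⟨by omega⟩
  let E := FiniteField.Extension K p (finrank K V)
  have hE : finrank K E = finrank K V := FiniteField.finrank_extension K p _
  have e : V ≃ₗ[K] E := LinearEquiv.ofFinrankEq V E hE.symm
  have h1 : LinearIndependent K ![(1 : E)] := by
    simp
  obtain ⟨x, hx⟩ := exists_linearIndependent_cons_of_lt_finrank h1 (by omega)
  obtain ⟨y, hy⟩ := exists_linearIndependent_cons_of_lt_finrank hx (by omega)
  refine ⟨e.symm.toLinearMap ∘ₗ LinearMap.mulLeft K x ∘ₗ e.toLinearMap,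
    e.symm.toLinearMap ∘ₗ LinearMap.mulLeft K y ∘ₗ e.toLinearMap, fun z a b c h ↦ ?_⟩
  have h' := congrArg e h
  simp only [LinearMap.coe_comp, LinearEquiv.coe_coe, Function.comp_apply, LinearMap.mulLeft_apply,
    map_add, map_smul, LinearEquiv.apply_symm_apply] at h'
  have h2 : (b • y + a • x + (-c) • (1 : E)) * e z = 0 := by
    rw [add_mul, add_mul, smul_mul_assoc, smul_mul_assoc, smul_mul_assoc, one_mul, neg_smul, ← h']
    abel
  rcases mul_eq_zero.1 h2 with h3 | h3
  · right
    rw [Fintype.linearIndependent_iff] at hy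
    have h4 := hy ![b, a, -c] (by rw [Fin.sum_univ_three]; exact h3)
    exact ⟨h4 1, h4 0⟩
  · left
    simpa using h3

theorem exists_pencil_on_submodule {K V : Type} [Field K] [Finite K] [AddCommGroup V]
    [Module K V] [FiniteDimensional K V] (W : Submodule K V) (hW : 3 ≤ finrank K W) :
    ∃ f g : V →ₗ[K] V, (∀ z, f z ∈ W) ∧ (∀ z, g z ∈ W) ∧
      ∀ z ∈ W, ∀ a b c : K, a • f z + b • g z = c • z → z = 0 ∨ (a = 0 ∧ b = 0) := by
  obtain ⟨f, g, h⟩ := exists_pencil_without_eigenvector hW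
  obtain ⟨f', hf'⟩ := LinearMap.exists_extend f
  obtain ⟨g', hg'⟩ := LinearMap.exists_extend g
  refine ⟨W.subtype ∘ₗ f', W.subtype ∘ₗ g', fun z ↦ (f' z).2, fun z ↦ (g' z).2,
    fun z hz a b c hc ↦ ?_⟩
  have e1 : f' z = f ⟨z, hz⟩ := by rw [← hf']; rfl
  have e2 : g' z = g ⟨z, hz⟩ := by rw [← hg']; rfl
  rcases h ⟨z, hz⟩ a b c (by ext; simpa [e1, e2] using hc) with h | h
  · exact Or.inl (by simpa using h)
  · exact Or.inr h

theorem two_le_finrank_span_pencil {K V : Type} [Field K] [AddCommGroup V]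
    [Module K V] [FiniteDimensional K V] {W : Submodule K V} {f g : V →ₗ[K] V}
    (h : ∀ z ∈ W, ∀ a b c : K, a • f z + b • g z = c • z → z = 0 ∨ (a = 0 ∧ b = 0))
    {x y : V} (hx : x ∈ W) (hy : y ∈ W) (hxy : x ≠ 0 ∨ y ≠ 0) :
    2 ≤ finrank K (Submodule.span K (Set.range ![f x + g y, x, y])) := by
  by_contra! hlt
  obtain ⟨⟨z, hz⟩, hmul⟩ := finrank_le_one_iff.1 (Nat.lt_succ_iff.1 hlt)
  have key : ∀ i, ∃ c : K, c • z = ![f x + g y, x, y] i := fun i ↦ by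
    obtain ⟨c, hc⟩ := hmul ⟨_, Submodule.subset_span ⟨i, rfl⟩⟩
    exact ⟨c, congrArg Subtype.val hc⟩
  obtain ⟨c, hc⟩ := key 0
  obtain ⟨a, ha⟩ := key 1
  obtain ⟨b, hb⟩ := key 2
  simp only [Matrix.cons_val_zero, Matrix.cons_val_one, Matrix.cons_val] at hc ha hb
  subst ha hb
  simp only [map_smul] at hc
  have hzW : z ∈ W := by
    by_cases h0 : a = 0
    · have hb0 : b ≠ 0 := by rintro rfl; simp [h0] at hxy
      exact (Submodule.smul_mem_iff W hb0).1 hy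
    · exact (Submodule.smul_mem_iff W h0).1 hx
  rcases h z hzW a b c hc.symm with h | ⟨h, h'⟩ <;> simp_all

theorem finrank_le_one_of_injOn {K V : Type} [Field K] [AddCommGroup V] [Module K V]
    (X : Submodule K V) (f : V →ₗ[K] K) (h : ∀ x ∈ X, f x = 0 → x = 0) : finrank K X ≤ 1 := by
  have hinj : Function.Injective (f.domRestrict X) := by
    rw [injective_iff_map_eq_zero]
    rintro ⟨x, hx⟩ h0
    exact Subtype.ext (h x hx h0)
  simpa using LinearMap.finrank_le_finrank_of_injective hinj

theorem finrank_span_inf_span_le_one {K P V : Type} [Field K] [AddCommGroup P] [Module K P]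
    [AddCommGroup V] [Module K V] (g g' : Fin 3 → P × V) (d : Fin 3 → V)
    (hd : ∀ i, g i - g' i = (0, d i))
    (h : ∀ c c' : Fin 3 → K, ∑ i, c i • g i = ∑ i, c' i • g' i → c = c')
    (hrank : 2 ≤ finrank K (Submodule.span K (Set.range d))) :
    finrank K (Submodule.span K (Set.range g) ⊓ Submodule.span K (Set.range g') :
      Submodule K (P × V)) ≤ 1 := by
  have hle : Submodule.span K (Set.range g) ⊓ Submodule.span K (Set.range g') ≤
      (LinearMap.ker (Fintype.linearCombination K d)).map (Fintype.linearCombination K g) := by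
    rintro x ⟨hx, hx'⟩
    obtain ⟨c, rfl⟩ := (Submodule.mem_span_range_iff_exists_fun K).1 hx
    obtain ⟨c', hc'⟩ := (Submodule.mem_span_range_iff_exists_fun K).1 hx'
    obtain rfl := h c c' hc'.symm
    refine ⟨c, ?_, rfl⟩
    have h0 : ∑ i, c i • (g i - g' i) = 0 := by
      simp [smul_sub, Finset.sum_sub_distrib, hc']
    simp only [hd] at h0
    have h2 := congrArg Prod.snd h0
    rw [Prod.snd_sum] at h2
    exact h2
  have hrn := LinearMap.finrank_range_add_finrank_ker (Fintype.linearCombination K d)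
  rw [Fintype.range_linearCombination, finrank_fintype_fun_eq_card, Fintype.card_fin] at hrn
  calc _ ≤ _ := Submodule.finrank_mono hle
    _ ≤ _ := Submodule.finrank_map_le _ _
    _ ≤ 1 := by omega

/-- `(u, v)` is the reduced row echelon basis, with pivots `a < b`, of a two-dimensional space. -/
structure IsReducedPair {K : Type} [Field K] {m : ℕ} (a b : Fin m) (u v : Fin m → K) : Prop where
  lt : a < b
  left_left : u a = 1
  left_right : u b = 0
  right_left : v a = 0
  right_right : v b = 1
  left_zero : ∀ k < a, u k = 0
  right_zero : ∀ k < b, v k = 0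

namespace IsReducedPair

variable {K : Type} [Field K] {m : ℕ} {a b a' b' : Fin m} {u v u' v' : Fin m → K}

theorem linearIndependent (h : IsReducedPair a b u v) : LinearIndependent K ![u, v] := by
  rw [LinearIndependent.pair_iff]
  intro s t hst
  have ha := congrFun hst a
  have hb := congrFun hst b
  simp [h.left_left, h.left_right, h.right_left, h.right_right] at ha hb
  exact ⟨ha, hb⟩

theorem left_pivot_unique (h : IsReducedPair a b u v) (h' : IsReducedPair a' b' u v) :
    a = a' := by
  rcases lt_trichotomy a a' with hlt | heq | hlt
  · have := h'.left_zero _ hlt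
    simp [h.left_left] at this
  · exact heq
  · have := h.left_zero _ hlt
    simp [h'.left_left] at this

theorem left_coeff_eq_zero (h : IsReducedPair a b u v) (h' : IsReducedPair a' b' u' v')
    {s t s' t' : K} (e : s • u + t • v = s' • u' + t' • v') (h1 : a ≠ a') (h2 : a ≠ b') :
    s = 0 := by
  have ev : ∀ k, s * u k + t * v k = s' * u' k + t' * v' k := fun k ↦ congrFun e k
  have ea := ev a
  have ea' := ev a'
  have eb' := ev b'
  simp only [h.left_left, h.right_left, h'.left_left, h'.left_right, h'.right_left,
    h'.right_right] at ea ea' eb'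
  have hab := h.lt
  have hs' : a' < a → s' = 0 := fun hlt ↦ by
    rw [h.left_zero _ hlt, h.right_zero _ (hlt.trans hab)] at ea'
    simpa using ea'.symm
  have ht' : b' < a → t' = 0 := fun hlt ↦ by
    rw [h.left_zero _ hlt, h.right_zero _ (hlt.trans hab)] at eb'
    simpa using eb'.symm
  have z1 : s' * u' a = 0 := by
    rcases lt_or_gt_of_ne h1 with hlt | hlt
    · rw [h'.left_zero _ hlt, mul_zero]
    · rw [hs' hlt, zero_mul]
  have z2 : t' * v' a = 0 := by
    rcases lt_or_gt_of_ne h2 with hlt | hlt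
    · rw [h'.right_zero _ hlt, mul_zero]
    · rw [ht' hlt, zero_mul]
  rw [z1, z2] at ea
  simpa using ea

theorem right_coeff_eq_zero (h : IsReducedPair a b u v) (h' : IsReducedPair a' b' u' v')
    {t s' t' : K} (e : t • v = s' • u' + t' • v') (h1 : b ≠ a') (h2 : b ≠ b') :
    t = 0 := by
  have ev : ∀ k, t * v k = s' * u' k + t' * v' k := fun k ↦ congrFun e k
  have eb := ev b
  have ea' := ev a'
  have eb' := ev b'
  simp only [h.right_right, h'.left_left, h'.left_right, h'.right_left,
    h'.right_right] at eb ea' eb'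
  have z1 : s' * u' b = 0 := by
    rcases lt_or_gt_of_ne h1 with hlt | hlt
    · rw [h'.left_zero _ hlt, mul_zero]
    · rw [h.right_zero _ hlt] at ea'
      rw [show s' = 0 by simpa using ea'.symm, zero_mul]
  have z2 : t' * v' b = 0 := by
    rcases lt_or_gt_of_ne h2 with hlt | hlt
    · rw [h'.right_zero _ hlt, mul_zero]
    · rw [h.right_zero _ hlt] at eb'
      rw [show t' = 0 by simpa using eb'.symm, zero_mul]
  rw [z1, z2] at eb
  simpa using eb

end IsReducedPair

theorem exists_leading_coordinate {K : Type} [Field K] {m : ℕ} {P : Submodule K (Fin m → K)}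
    (hP : P ≠ ⊥) : ∃ (a : Fin m) (u : Fin m → K), u ∈ P ∧ u a = 1 ∧ ∀ x ∈ P, ∀ k < a, x k = 0 := by
  classical
  obtain ⟨x, hx, hx0⟩ := Submodule.exists_mem_ne_zero_of_ne_bot hP
  obtain ⟨k, hk⟩ := Function.ne_iff.1 hx0
  have hwf : ({k | ∃ x ∈ P, x k ≠ 0} : Set (Fin m)).Nonempty := ⟨k, x, hx, hk⟩
  obtain ⟨a, ⟨y, hy, hya⟩, hmin⟩ := WellFounded.has_min (wellFounded_lt (α := Fin m)) _ hwf
  refine ⟨a, (y a)⁻¹ • y, P.smul_mem _ hy, inv_mul_cancel₀ hya, fun x hx k hk ↦ ?_⟩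
  by_contra h0
  exact hmin k ⟨x, hx, h0⟩ hk

theorem exists_isReducedPair {K : Type} [Field K] {m : ℕ} (P : Submodule K (Fin m → K))
    (hP : finrank K P = 2) :
    ∃ (a b : Fin m) (u v : Fin m → K), IsReducedPair a b u v ∧
      Submodule.span K (Set.range ![u, v]) = P := by
  have hP0 : P ≠ ⊥ := by rintro rfl; simp at hP
  obtain ⟨a, x, hx, hxa, hmin⟩ := exists_leading_coordinate hP0
  have hQ0 : P ⊓ LinearMap.ker (LinearMap.proj a : (Fin m → K) →ₗ[K] K) ≠ ⊥ := by
    intro hbot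
    have := finrank_le_one_of_injOn P (LinearMap.proj a) fun y hy hy0 ↦ by
      have : y ∈ P ⊓ LinearMap.ker (LinearMap.proj a : (Fin m → K) →ₗ[K] K) := ⟨hy, hy0⟩
      rwa [hbot, Submodule.mem_bot] at this
    omega
  obtain ⟨b, v, ⟨hv, hva⟩, hvb, hmin'⟩ := exists_leading_coordinate hQ0
  replace hva : v a = 0 := hva
  have hab : a < b := by
    rcases lt_trichotomy a b with h | h | h
    · exact h
    · subst h; simp [hva] at hvb
    · rw [hmin v hv b h] at hvb; simp at hvb
  have hred : IsReducedPair a b (x - x b • v) v :=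
    { lt := hab
      left_left := by simp [hxa, hva]
      left_right := by simp [hvb]
      right_left := hva
      right_right := hvb
      left_zero := fun k hk ↦ by simp [hmin x hx k hk, hmin v hv k hk]
      right_zero := fun k hk ↦ hmin' v ⟨hv, hva⟩ k hk }
  refine ⟨a, b, _, v, hred, Submodule.eq_of_le_of_finrank_eq ?_ ?_⟩
  · rw [Submodule.span_le]
    rintro _ ⟨i, rfl⟩
    fin_cases i
    · exact P.sub_mem hx (P.smul_mem _ hv)
    · exact hv
  · rw [finrank_span_eq_card hred.linearIndependent, hP, Fintype.card_fin]

theorem exists_proper_edge_coloring {r : ℕ} (hr : Even r) (hr2 : 2 ≤ r) :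
    ∃ c : Fin r → Fin r → Fin (r - 1), ∀ a b a' b', a < b → a' < b' → c a b = c a' b' →
      (a = a' ∧ b = b') ∨ (a ≠ a' ∧ a ≠ b' ∧ b ≠ a' ∧ b ≠ b') := by
  refine ⟨fun a b ↦ ⟨(if (b : ℕ) = r - 1 then 2 * (a : ℕ) else a + b) % (r - 1),
    Nat.mod_lt _ (by omega)⟩, ?_⟩
  rintro ⟨a, ha⟩ ⟨b, hb⟩ ⟨a', ha'⟩ ⟨b', hb'⟩ hab hab' hc
  simp only [Fin.mk_lt_mk, Fin.mk.injEq, ne_eq] at *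
  have key : ∀ s t N : ℕ, s < 2 * N → t < 2 * N → s % N = t % N →
      s = t ∨ s = t + N ∨ t = s + N := by
    intro s t N hs ht h
    have h1 := Nat.div_add_mod s N
    have h2 := Nat.div_add_mod t N
    have h3 : s / N < 2 := Nat.div_lt_of_lt_mul (by omega)
    have h4 : t / N < 2 := Nat.div_lt_of_lt_mul (by omega)
    rw [h] at h1
    interval_cases s / N <;> interval_cases t / N <;> omega
  obtain ⟨w, rfl⟩ := hr
  have := key _ _ _ (by split_ifs <;> omega) (by split_ifs <;> omega) hc
  split_ifs at this <;> omega

theorem exists_pairwise_nonproportional {K : Type} [Field K] [Fintype K] {q : ℕ}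
    (hq : Fintype.card K = q) : ∃ p : Fin (q ^ 2 + q + 1) → Fin 3 → K, (∀ i, p i ≠ 0) ∧
      ∀ i j, ∀ s t : K, s • p i = t • p j → s ≠ 0 → i = j := by
  have hcard : Nat.card (Projectivization K (Fin 3 → K)) = q ^ 2 + q + 1 := by
    rw [Projectivization.card_of_finrank K _ (finrank_fin_fun K), Nat.card_eq_fintype_card, hq]
    simp [Finset.sum_range_succ]
    ring
  have e : Fin (q ^ 2 + q + 1) ≃ Projectivization K (Fin 3 → K) :=
    (finCongr hcard.symm).trans (Finite.equivFin _).symm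
  refine ⟨fun i ↦ (e i).rep, fun i ↦ (e i).rep_nonzero, fun i j s t h hs ↦ e.injective ?_⟩
  rw [← (e i).mk_rep, ← (e j).mk_rep, Projectivization.mk_eq_mk_iff']
  exact ⟨s⁻¹ * t, by rw [mul_smul, ← h, inv_smul_smul₀ hs]⟩

/-- The vector of length `m` with `s` leading zeros, followed by `u` and then by `x`. -/
def blockVec {K : Type} [Field K] {m s r : ℕ} (u : Fin r → K) (x : Fin (m - (s + r)) → K) :
    Fin m → K := fun k ↦
  if (k : ℕ) < s then 0
  else if h : (k : ℕ) - s < r then u ⟨k - s, h⟩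
  else if h' : (k : ℕ) - (s + r) < m - (s + r) then x ⟨k - (s + r), h'⟩ else 0

theorem blockVec_of_lt {K : Type} [Field K] {m s r : ℕ} (u : Fin r → K)
    (x : Fin (m - (s + r)) → K) {k : Fin m} (hk : (k : ℕ) < s) :
    blockVec u x k = 0 := by
  simp [blockVec, hk]

theorem blockVec_of_eq {K : Type} [Field K] {m s r : ℕ} (u : Fin r → K)
    (x : Fin (m - (s + r)) → K) {k : Fin m} (l : Fin r) (hk : (k : ℕ) = s + l) :
    blockVec u x k = u l := by
  simp [blockVec, hk]

theorem blockVec_of_eq_add {K : Type} [Field K] {m s r : ℕ} (u : Fin r → K)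
    (x : Fin (m - (s + r)) → K) {k : Fin m} (l : Fin (m - (s + r)))
    (hk : (k : ℕ) = s + r + l) :
    blockVec u x k = x l := by
  have h1 : ¬ (s + r + (l : ℕ) < s) := by omega
  have h2 : ¬ (s + r + (l : ℕ) - s < r) := by omega
  simp [blockVec, hk, h1, h2]

theorem blockVec_injective {K : Type} [Field K] {m s r : ℕ} (hs : s + r ≤ m) {u u' : Fin r → K}
    {x x' : Fin (m - (s + r)) → K}
    (h : (blockVec u x : Fin m → K) = blockVec u' x') : u = u' ∧ x = x' := by
  constructor
  · ext l
    have := congrFun h ⟨s + l, by omega⟩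
    rwa [blockVec_of_eq _ _ l rfl, blockVec_of_eq _ _ l rfl] at this
  · ext l
    have := congrFun h ⟨s + r + l, by omega⟩
    rwa [blockVec_of_eq_add _ _ l rfl, blockVec_of_eq_add _ _ l rfl] at this

theorem IsReducedPair.blockVec {K : Type} [Field K] {m s r : ℕ} (hs : s + r ≤ m) {a b : Fin r}
    {u v : Fin r → K} (h : IsReducedPair a b u v) (x y : Fin (m - (s + r)) → K) :
    IsReducedPair (⟨s + a, by omega⟩ : Fin m) ⟨s + b, by omega⟩
      (blockVec u x) (blockVec v y) where
  lt := by simpa using h.lt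
  left_left := by rw [blockVec_of_eq _ _ a rfl, h.left_left]
  left_right := by rw [blockVec_of_eq _ _ b rfl, h.left_right]
  right_left := by rw [blockVec_of_eq _ _ a rfl, h.right_left]
  right_right := by rw [blockVec_of_eq _ _ b rfl, h.right_right]
  left_zero := fun ⟨k, hkm⟩ hk ↦ by
    have hk : k < s + a := hk
    by_cases hks : k < s
    · exact blockVec_of_lt _ _ hks
    · rw [blockVec_of_eq _ _ ⟨k - s, by omega⟩ (by simp; omega)]
      exact h.left_zero _ (Fin.mk_lt_of_lt_val (by omega))
  right_zero := fun ⟨k, hkm⟩ hk ↦ by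
    have hk : k < s + b := hk
    by_cases hks : k < s
    · exact blockVec_of_lt _ _ hks
    · rw [blockVec_of_eq _ _ ⟨k - s, by omega⟩ (by simp; omega)]
      exact h.right_zero _ (Fin.mk_lt_of_lt_val (by omega))

theorem exists_colored_lines {K : Type} [Field K] [Fintype K] {m r : ℕ} (hr : Even r)
    (hr2 : 2 ≤ r) :
    ∃ (J : Type) (a b : J → Fin m) (u v : J → Fin m → K) (col : J → Fin (r - 1)),
      Finite J ∧
      Nat.card J = ∑ i ∈ Finset.Icc 1 (m / r),
        gaussNat K r 2 * Fintype.card K ^ (2 * (m - r * i)) ∧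
      (∀ j, IsReducedPair (a j) (b j) (u j) (v j)) ∧
      (∀ j j', u j = u j' → v j = v j' → j = j') ∧
      (∀ j j', a j = a j' → b j = b j' → col j = col j') ∧
      (∀ j j', col j = col j' → (a j = a j' ∧ b j = b j') ∨
        (a j ≠ a j' ∧ a j ≠ b j' ∧ b j ≠ a j' ∧ b j ≠ b j')) := by
  obtain ⟨c, hc⟩ := exists_proper_edge_coloring hr hr2
  choose A B U V hred hspan using fun P : {P : Submodule K (Fin r → K) // finrank K P = 2} ↦
    exists_isReducedPair P.1 P.2
  have hm : ∀ i : Fin (m / r), r * (i : ℕ) + r ≤ m := fun i ↦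
    calc r * (i : ℕ) + r = r * (i + 1) := by ring
      _ ≤ r * (m / r) := Nat.mul_le_mul_left _ i.2
      _ ≤ m := Nat.mul_div_le m r
  have hblock : ∀ (i i' : Fin (m / r)) (x x' : Fin r),
      r * (i : ℕ) + x = r * (i' : ℕ) + x' → i = i' ∧ x = x' := by
    intro i i' x x' h
    have h1 : (r * (i : ℕ) + x) / r = i := by
      rw [Nat.mul_add_div (by omega), Nat.div_eq_of_lt x.2, add_zero]
    have h2 : (r * (i' : ℕ) + x') / r = i' := by
      rw [Nat.mul_add_div (by omega), Nat.div_eq_of_lt x'.2, add_zero]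
    have h3 : (i : ℕ) = i' := by rw [← h1, ← h2, h]
    rw [h3] at h
    exact ⟨Fin.ext h3, Fin.ext (by omega)⟩
  refine ⟨Σ i : Fin (m / r), {P : Submodule K (Fin r → K) // finrank K P = 2} ×
      (Fin (m - (r * i + r)) → K) × (Fin (m - (r * i + r)) → K),
    fun j ↦ ⟨r * j.1 + A j.2.1, by have := hm j.1; omega⟩,
    fun j ↦ ⟨r * j.1 + B j.2.1, by have := hm j.1; omega⟩,
    fun j ↦ blockVec (U j.2.1) j.2.2.1, fun j ↦ blockVec (V j.2.1) j.2.2.2,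
    fun j ↦ c (A j.2.1) (B j.2.1), inferInstance, ?_, fun j ↦ (hred _).blockVec (hm _) _ _,
    ?_, ?_, ?_⟩
  · have hcard : ∀ i : ℕ, Nat.card ({P : Submodule K (Fin r → K) // finrank K P = 2} ×
        (Fin (m - (r * i + r)) → K) × (Fin (m - (r * i + r)) → K)) =
        gaussNat K r 2 * Fintype.card K ^ (2 * (m - r * (i + 1))) := fun i ↦ by
      rw [Nat.card_prod, Nat.card_prod, Nat.card_fun, Nat.card_fin, Nat.card_eq_fintype_card (α := K),
        ← pow_add, ← two_mul]
      rfl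
    rw [Nat.card_sigma]
    simp only [hcard]
    rw [← Finset.sum_range fun i ↦ gaussNat K r 2 * Fintype.card K ^ (2 * (m - r * (i + 1))),
      Finset.range_eq_Ico,
      Finset.sum_Ico_add' (fun i ↦ gaussNat K r 2 * Fintype.card K ^ (2 * (m - r * i))) 0 _ 1]
    rfl
  · rintro ⟨i, P, x, y⟩ ⟨i', P', x', y'⟩ hu hv
    simp only at hu hv
    have h := (hred P).blockVec (hm i) x y
    rw [hu, hv] at h
    have ha := h.left_pivot_unique ((hred P').blockVec (hm i') x' y')
    obtain ⟨rfl, -⟩ := hblock _ _ _ _ (Fin.mk.inj ha)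
    obtain ⟨h1, rfl⟩ := blockVec_injective (hm i) hu
    obtain ⟨h2, rfl⟩ := blockVec_injective (hm i) hv
    obtain rfl : P = P' := Subtype.ext (by rw [← hspan P, ← hspan P', h1, h2])
    rfl
  · rintro ⟨i, P, x, y⟩ ⟨i', P', x', y'⟩ ha hb
    simp only [Fin.mk.injEq] at ha hb ⊢
    rw [(hblock _ _ _ _ ha).2, (hblock _ _ _ _ hb).2]
  · rintro ⟨i, P, x, y⟩ ⟨i', P', x', y'⟩ h
    simp only [Fin.mk.injEq, ne_eq] at h ⊢
    rcases hc _ _ _ _ (hred P).lt (hred P').lt h with ⟨h1, h2⟩ | ⟨h1, h2, h3, h4⟩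
    · by_cases hi : i = i'
      · left; subst hi; simp [h1, h2]
      · right
        exact ⟨fun h ↦ hi (hblock _ _ _ _ h).1, fun h ↦ hi (hblock _ _ _ _ h).1,
          fun h ↦ hi (hblock _ _ _ _ h).1, fun h ↦ hi (hblock _ _ _ _ h).1⟩
    · right
      exact ⟨fun h ↦ h1 (hblock _ _ _ _ h).2, fun h ↦ h2 (hblock _ _ _ _ h).2,
        fun h ↦ h3 (hblock _ _ _ _ h).2, fun h ↦ h4 (hblock _ _ _ _ h).2⟩

theorem mem_span_codeword_iff {K P V : Type} [Field K] [AddCommGroup P] [Module K P]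
    [AddCommGroup V] [Module K V] {p : P} {w u v : V} {x : P × V} :
    x ∈ Submodule.span K (Set.range ![(p, w), (0, u), (0, v)]) ↔
      ∃ c s t : K, x = (c • p, c • w + (s • u + t • v)) := by
  rw [Submodule.mem_span_range_iff_exists_fun]
  constructor
  · rintro ⟨c, rfl⟩
    exact ⟨c 0, c 1, c 2, by ext <;> simp [Fin.sum_univ_three, add_assoc]⟩
  · rintro ⟨c, s, t, rfl⟩
    exact ⟨![c, s, t], by ext <;> simp [Fin.sum_univ_three, add_assoc]⟩

namespace IsReducedPair

variable {K : Type} [Field K] {m : ℕ} {a b a' b' : Fin m} {u v u' v' w w' : Fin m → K}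
  {p p' : Fin 3 → K}

theorem coeff_eq (h : IsReducedPair a b u v) (h' : IsReducedPair a b u' v')
    (hp : p ≠ 0) (hwa : w a = 0) (hwb : w b = 0) (hwa' : w' a = 0) (hwb' : w' b = 0)
    (c c' : Fin 3 → K) (e : ∑ i, c i • ![(p, w), (0, u), (0, v)] i =
      ∑ i, c' i • ![(p, w'), (0, u'), (0, v')] i) : c = c' := by
  simp only [Fin.sum_univ_three, Matrix.cons_val_zero, Matrix.cons_val_one, Matrix.cons_val,
    Prod.smul_mk, Prod.mk_add_mk, smul_zero, add_zero, Prod.mk.injEq] at e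
  obtain ⟨e1, e2⟩ := e
  have ea := congrFun e2 a
  have eb := congrFun e2 b
  simp only [Pi.add_apply, Pi.smul_apply, smul_eq_mul, hwa, hwb, hwa', hwb', h.left_left,
    h.left_right, h.right_left, h.right_right, h'.left_left, h'.left_right, h'.right_left,
    h'.right_right, mul_zero, mul_one, zero_add, add_zero] at ea eb
  ext i
  fin_cases i
  · exact smul_left_injective K hp e1
  · exact ea
  · exact eb

theorem finrank_codeword (h : IsReducedPair a b u v) (hp : p ≠ 0) (hwa : w a = 0)
    (hwb : w b = 0) :
    finrank K (Submodule.span K (Set.range ![(p, w), (0, u), (0, v)])) = 3 := by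
  rw [finrank_span_eq_card, Fintype.card_fin]
  rw [Fintype.linearIndependent_iff]
  intro c hc
  exact congrFun (h.coeff_eq h hp hwa hwb hwa hwb c 0 (by simpa using hc))

theorem finrank_inf_le_one_of_disjoint (h : IsReducedPair a b u v) (h' : IsReducedPair a' b' u' v')
    (hp : p ≠ 0) (hp' : p' ≠ 0) (h1 : a ≠ a') (h2 : a ≠ b') (h3 : b ≠ a') (h4 : b ≠ b') :
    finrank K (Submodule.span K (Set.range ![(p, w), (0, u), (0, v)]) ⊓
      Submodule.span K (Set.range ![(p', w'), (0, u'), (0, v')]) :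
      Submodule K ((Fin 3 → K) × (Fin m → K))) ≤ 1 := by
  obtain ⟨i, hi⟩ := Function.ne_iff.1 hp
  refine finrank_le_one_of_injOn _ (LinearMap.proj i ∘ₗ LinearMap.fst K _ _) ?_
  rintro x ⟨hx, hx'⟩ hfx
  obtain ⟨c, s, t, rfl⟩ := mem_span_codeword_iff.1 hx
  obtain ⟨c', s', t', e⟩ := mem_span_codeword_iff.1 hx'
  have hc : c = 0 := by simpa [show p i ≠ 0 from hi] using hfx
  subst hc
  simp only [zero_smul, zero_add, Prod.mk.injEq] at e
  have hc' : c' = 0 := by simpa [hp'] using e.1.symm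
  subst hc'
  have e2 := e.2
  rw [zero_smul, zero_add] at e2
  obtain rfl := h.left_coeff_eq_zero h' e2 h1 h2
  rw [zero_smul, zero_add] at e2
  obtain rfl := h.right_coeff_eq_zero h' e2 h3 h4
  simp

theorem finrank_inf_le_one_of_nonproportional (h : IsReducedPair a b u v)
    (h' : IsReducedPair a' b' u' v') (hpp : ∀ s t : K, s • p = t • p' → s = 0)
    (hp' : p' ≠ 0) (hne : ¬ (a = a' ∧ b = b')) :
    finrank K (Submodule.span K (Set.range ![(p, w), (0, u), (0, v)]) ⊓
      Submodule.span K (Set.range ![(p', w'), (0, u'), (0, v')]) :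
      Submodule K ((Fin 3 → K) × (Fin m → K))) ≤ 1 := by
  have key : ∀ x ∈ (Submodule.span K (Set.range ![(p, w), (0, u), (0, v)]) ⊓
      Submodule.span K (Set.range ![(p', w'), (0, u'), (0, v')]) :
      Submodule K ((Fin 3 → K) × (Fin m → K))),
      ∃ s t s' t' : K, x = (0, s • u + t • v) ∧ s • u + t • v = s' • u' + t' • v' := by
    rintro x ⟨hx, hx'⟩
    obtain ⟨c, s, t, rfl⟩ := mem_span_codeword_iff.1 hx
    obtain ⟨c', s', t', e⟩ := mem_span_codeword_iff.1 hx'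
    simp only [Prod.mk.injEq] at e
    obtain rfl := hpp _ _ e.1
    have e1 := e.1
    rw [zero_smul] at e1
    have hc' : c' = 0 := by simpa [hp'] using e1.symm
    subst hc'
    exact ⟨s, t, s', t', by simp, by simpa using e.2⟩
  by_cases hA : a ≠ a' ∧ a ≠ b'
  · refine finrank_le_one_of_injOn _ (LinearMap.proj b ∘ₗ LinearMap.snd K _ _) fun x hx hfx ↦ ?_
    obtain ⟨s, t, s', t', rfl, e⟩ := key x hx
    obtain rfl := h.left_coeff_eq_zero h' e hA.1 hA.2
    have ht : t = 0 := by simpa [h.right_right] using hfx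
    simp [ht]
  · have hB : b ≠ a' ∧ b ≠ b' := by
      have h1 := h.lt
      have h2 := h'.lt
      simp only [Fin.ext_iff, Fin.lt_def, ne_eq] at *
      omega
    refine finrank_le_one_of_injOn _ (LinearMap.proj a ∘ₗ LinearMap.snd K _ _) fun x hx hfx ↦ ?_
    obtain ⟨s, t, s', t', rfl, e⟩ := key x hx
    have hs : s = 0 := by simpa [h.left_left, h.right_left] using hfx
    subst hs
    rw [zero_smul, zero_add] at e
    obtain rfl := h.right_coeff_eq_zero h' e hB.1 hB.2
    simp

end IsReducedPair

theorem exists_extra_codewords {K : Type} [Field K] [Fintype K] {q m : ℕ}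
    (hq : Fintype.card K = q) (hm : 5 ≤ m) :
    ∃ (J : Type) (X : J → Submodule K ((Fin 3 → K) × (Fin m → K))),
      Finite J ∧
      Nat.card J = ∑ i ∈ Finset.Icc 1 (m / (q ^ 2 + q + 2)),
        gaussNat K (q ^ 2 + q + 2) 2 * q ^ (2 * (m - (q ^ 2 + q + 2) * i)) ∧
      (∀ j, finrank K (X j) = 3) ∧
      (∀ j j', j ≠ j' → finrank K (X j ⊓ X j' : Submodule K _) ≤ 1) ∧
      (∀ j, ∃ p : Fin 3 → K, p ≠ 0 ∧ ∀ x ∈ X j, ∃ c : K, x.1 = c • p) := by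
  have heven : Even (q ^ 2 + q + 2) := by
    rw [show q ^ 2 + q + 2 = q * (q + 1) + 2 by ring]
    exact (Nat.even_mul_succ_self q).add even_two
  obtain ⟨J, a, b, u, v, col, hJ, hcard, hred, hinj, hcol, hcol'⟩ :=
    exists_colored_lines (K := K) (m := m) heven (by omega)
  obtain ⟨p, hp0, hp⟩ := exists_pairwise_nonproportional hq
  let W : Fin m → Fin m → Submodule K (Fin m → K) := fun a b ↦ LinearMap.ker
    ((LinearMap.proj a : (Fin m → K) →ₗ[K] K).prod (LinearMap.proj b : (Fin m → K) →ₗ[K] K))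
  have hWmem : ∀ a b z, z ∈ W a b ↔ z a = 0 ∧ z b = 0 := fun a b z ↦ by
    simp [W, LinearMap.mem_ker]
  have hW : ∀ a b, 3 ≤ finrank K (W a b) := fun a b ↦ by
    have h1 := LinearMap.finrank_range_add_finrank_ker
      ((LinearMap.proj a : (Fin m → K) →ₗ[K] K).prod (LinearMap.proj b : (Fin m → K) →ₗ[K] K))
    have h2 := Submodule.finrank_le (LinearMap.range
      ((LinearMap.proj a : (Fin m → K) →ₗ[K] K).prod (LinearMap.proj b : (Fin m → K) →ₗ[K] K)))
    rw [finrank_fin_fun] at h1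
    rw [finrank_prod, finrank_self] at h2
    change 3 ≤ finrank K (LinearMap.ker _)
    omega
  choose f g hf hg hfg using fun a b ↦ exists_pencil_on_submodule (W a b) (hW a b)
  let w : J → Fin m → K := fun j ↦ f (a j) (b j) (u j) + g (a j) (b j) (v j)
  have hw : ∀ j, w j (a j) = 0 ∧ w j (b j) = 0 := fun j ↦
    (hWmem _ _ _).1 ((W _ _).add_mem (hf _ _ _) (hg _ _ _))
  refine ⟨J, fun j ↦ Submodule.span K (Set.range ![(p (col j), w j), (0, u j), (0, v j)]), hJ,
    by rw [hcard, hq], fun j ↦ (hred j).finrank_codeword (hp0 _) (hw j).1 (hw j).2, ?_, ?_⟩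
  · intro j j' hjj'
    by_cases hpair : a j = a j' ∧ b j = b j'
    · have hj' := hred j'
      have hw' := hw j'
      rw [← hpair.1, ← hpair.2] at hj' hw'
      have hcc := hcol j j' hpair.1 hpair.2
      have hw2 : w j' = f (a j) (b j) (u j') + g (a j) (b j) (v j') := by
        simp only [w, hpair.1, hpair.2]
      have hdu : u j - u j' ∈ W (a j) (b j) := by
        rw [hWmem]
        simp [(hred j).left_left, (hred j).left_right, hj'.left_left, hj'.left_right]
      have hdv : v j - v j' ∈ W (a j) (b j) := by
        rw [hWmem]
        simp [(hred j).right_left, (hred j).right_right, hj'.right_left, hj'.right_right]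
      refine finrank_span_inf_span_le_one _ _ ![f (a j) (b j) (u j - u j') +
        g (a j) (b j) (v j - v j'), u j - u j', v j - v j'] ?_ ?_
        (two_le_finrank_span_pencil (hfg _ _) hdu hdv ?_)
      · intro i
        fin_cases i
        · simp only [Fin.zero_eta, Matrix.cons_val_zero, ← hcc, hw2, Prod.mk_sub_mk, sub_self,
            map_sub, w]
          congr 1
          abel
        · simp
        · simp
      · rw [← hcc]
        exact (hred j).coeff_eq hj' (hp0 _) (hw j).1 (hw j).2 hw'.1 hw'.2
      · by_contra! h
        exact hjj' (hinj j j' (sub_eq_zero.1 h.1) (sub_eq_zero.1 h.2))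
    · by_cases hc : col j = col j'
      · rcases hcol' j j' hc with h | ⟨h1, h2, h3, h4⟩
        · exact absurd h hpair
        · exact (hred j).finrank_inf_le_one_of_disjoint (hred j') (hp0 _) (hp0 _) h1 h2 h3 h4
      · refine (hred j).finrank_inf_le_one_of_nonproportional (hred j') (fun s t h ↦ ?_) (hp0 _)
          hpair
        by_contra hs
        exact hc (hp _ _ s t h hs)
  · refine fun j ↦ ⟨p (col j), hp0 _, fun x hx ↦ ?_⟩
    obtain ⟨c, s, t, rfl⟩ := mem_span_codeword_iff.1 hx
    exact ⟨c, rfl⟩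

theorem exists_isMRD {K : Type} [Field K] [Fintype K] {n : ℕ} (hn : 6 ≤ n) :
    ∃ C : Submodule K (Matrix (Fin 3) (Fin (n - 3)) K), IsMRD K n 3 2 C := by
  obtain ⟨f, g, -, -, h⟩ := exists_pencil_on_submodule
    (⊤ : Submodule K (Fin (n - 3) → K)) (by rw [finrank_top, finrank_fin_fun]; omega)
  let T : (Fin (n - 3) → K) × (Fin (n - 3) → K) →ₗ[K] Matrix (Fin 3) (Fin (n - 3)) K :=
    { toFun := fun x ↦ Matrix.of ![f x.1 + g x.2, x.1, x.2]
      map_add' := fun x y ↦ by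
        ext i k
        fin_cases i <;> simp
        ring
      map_smul' := fun c x ↦ by
        ext i k
        fin_cases i <;> simp [mul_add] }
  have hT : Function.Injective T := by
    intro x y hxy
    exact Prod.ext (congrFun hxy 1) (congrFun hxy 2)
  refine ⟨LinearMap.range T, ?_, ?_⟩
  · rw [LinearMap.finrank_range_of_inj hT, finrank_prod, finrank_fin_fun]
    ring
  · rintro _ ⟨x, rfl⟩ hx
    rw [Matrix.rank_eq_finrank_span_row]
    refine two_le_finrank_span_pencil h trivial trivial ?_
    by_contra! h0
    exact hx (by rw [show x = 0 from Prod.ext h0.1 h0.2, map_zero])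

/-- Concatenation of the first three coordinates with the remaining ones. -/
def concatThree (K : Type) [Field K] (n : ℕ) :
    (Fin 3 → K) × (Fin (n - 3) → K) →ₗ[K] (Fin n → K) where
  toFun x := fun j ↦ if h : (j : ℕ) < 3 then x.1 ⟨j, h⟩ else x.2 ⟨j - 3, by omega⟩
  map_add' x y := by ext j; simp only [Pi.add_apply]; split_ifs <;> rfl
  map_smul' c x := by ext j; simp only [Pi.smul_apply]; split_ifs <;> rfl

theorem concatThree_injective (K : Type) [Field K] {n : ℕ} (hn : 3 ≤ n) :
    Function.Injective (concatThree K n) := by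
  intro x y h
  refine Prod.ext (funext fun i ↦ ?_) (funext fun i ↦ ?_)
  · simpa [concatThree] using congrFun h ⟨i, by omega⟩
  · simpa [concatThree] using congrFun h ⟨i + 3, by omega⟩

theorem liftSubspace_eq_map {K : Type} [Field K] {n : ℕ}
    (A : Matrix (Fin 3) (Fin (n - 3)) K) :
    liftSubspace K n 3 A = (Submodule.span K (Set.range fun i : Fin 3 ↦
      ((Pi.single i 1 : Fin 3 → K), A i))).map (concatThree K n) := by
  rw [Submodule.map_span, ← Set.range_comp, liftSubspace]
  congr 2
  ext i j
  simp only [liftMatrix, concatThree, Matrix.of_apply, Function.comp_apply, LinearMap.coe_mk,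
    AddHom.coe_mk, Pi.single_apply, Fin.ext_iff]
  split_ifs <;> first | rfl | omega

theorem fst_sum_smul_lift {K V : Type} [Field K] [AddCommGroup V] [Module K V]
    (A : Fin 3 → V) (c : Fin 3 → K) :
    (∑ i, c i • ((Pi.single i 1 : Fin 3 → K), A i)).1 = c := by
  ext k
  simp [Prod.fst_sum, Finset.sum_apply, Pi.single_apply]

theorem finrank_span_lift {K V : Type} [Field K] [AddCommGroup V] [Module K V]
    (A : Fin 3 → V) :
    finrank K (Submodule.span K (Set.range fun i : Fin 3 ↦
      ((Pi.single i 1 : Fin 3 → K), A i))) = 3 := by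
  rw [finrank_span_eq_card, Fintype.card_fin]
  rw [Fintype.linearIndependent_iff]
  intro c hc
  rw [← fst_sum_smul_lift A c, hc]
  simp

theorem finrank_lift_inf_lift_le_one {K : Type} [Field K] {m : ℕ} {A B : Matrix (Fin 3) (Fin m) K}
    (h : 2 ≤ (A - B).rank) :
    finrank K (Submodule.span K (Set.range fun i : Fin 3 ↦ ((Pi.single i 1 : Fin 3 → K), A i)) ⊓
      Submodule.span K (Set.range fun i : Fin 3 ↦ ((Pi.single i 1 : Fin 3 → K), B i)) :
      Submodule K ((Fin 3 → K) × (Fin m → K))) ≤ 1 := by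
  rw [Matrix.rank_eq_finrank_span_row] at h
  refine finrank_span_inf_span_le_one _ _ (A - B).row (fun i ↦ ?_) (fun c c' e ↦ ?_) h
  · simp [Matrix.row, Pi.sub_def]
    rfl
  · exact (fst_sum_smul_lift A c).symm.trans
      ((congrArg Prod.fst e).trans (fst_sum_smul_lift B c'))

theorem finrank_lift_inf_le_one {K V : Type} [Field K] [AddCommGroup V] [Module K V]
    (A : Fin 3 → V) {X : Submodule K ((Fin 3 → K) × V)} {p : Fin 3 → K} (hp : p ≠ 0)
    (hX : ∀ x ∈ X, ∃ c : K, x.1 = c • p) :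
    finrank K (Submodule.span K (Set.range fun i : Fin 3 ↦ ((Pi.single i 1 : Fin 3 → K), A i)) ⊓ X :
      Submodule K ((Fin 3 → K) × V)) ≤ 1 := by
  obtain ⟨i, hi⟩ := Function.ne_iff.1 hp
  refine finrank_le_one_of_injOn _ (LinearMap.proj i ∘ₗ LinearMap.fst K _ _) ?_
  rintro x ⟨hx, hx'⟩ hfx
  obtain ⟨c, hc⟩ := hX x hx'
  have hc0 : c = 0 := by simpa [hc, show p i ≠ 0 from hi] using hfx
  obtain ⟨d, rfl⟩ := (Submodule.mem_span_range_iff_exists_fun K).1 hx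
  rw [fst_sum_smul_lift, hc0, zero_smul] at hc
  simp [hc]

theorem ncard_le_Aq {K : Type} [Field K] [Fintype K] {n d k : ℕ}
    {S : Set (Submodule K (Fin n → K))} (hS : ∀ X ∈ S, finrank K X = k)
    (hd : ∀ X ∈ S, ∀ Y ∈ S, X ≠ Y → d ≤ subDist K X Y) : S.ncard ≤ Aq K n d k := by
  refine le_csSup ⟨Nat.card (Submodule K (Fin n → K)), ?_⟩ ⟨S, S.toFinite, rfl, hS, hd⟩
  rintro _ ⟨T, -, rfl, -⟩
  exact Set.ncard_le_card T

/-- (Construction II.) Let `n ≥ 8`, `s = n-4` for odd `n` and `s = n-3` for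
even `n`, and suppose `q² + q + 1 < s`. With `α = ⌊(n-3)/(q²+q+2)⌋`, there exists an
`(n, M, 4, 3)_q` constant dimension code containing an `(n,3,2)_q` lifted MRD code with
`M = q^{2(n-3)} + ∑_{i=1}^{α} Gauss[q²+q+2, 2]_q · q^{2(n-3-(q²+q+2)i)}`;
in particular `A_q(n,4,3) ≥ M`. -/
theorem stmt13 (q n : ℕ) (hq : Fintype.card F = q) (hn : 8 ≤ n)
    (hs : q ^ 2 + q + 1 < (if n % 2 = 1 then n - 4 else n - 3)) :
    ∃ (C : Submodule F (Matrix (Fin 3) (Fin (n - 3)) F))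
      (S : Set (Submodule F (Fin n → F))),
      IsMRD F n 3 2 C ∧ liftedCode F n 3 C ⊆ S ∧ S.Finite ∧
      S.ncard = q ^ (2 * (n - 3)) +
        ∑ i ∈ Finset.Icc 1 ((n - 3) / (q ^ 2 + q + 2)),
          gaussNat F (q ^ 2 + q + 2) 2 * q ^ (2 * (n - 3 - (q ^ 2 + q + 2) * i)) ∧
      (∀ X ∈ S, finrank F X = 3) ∧
      (∀ X ∈ S, ∀ Y ∈ S, X ≠ Y → 4 ≤ subDist F X Y) ∧
      q ^ (2 * (n - 3)) +
        ∑ i ∈ Finset.Icc 1 ((n - 3) / (q ^ 2 + q + 2)),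
          gaussNat F (q ^ 2 + q + 2) 2 * q ^ (2 * (n - 3 - (q ^ 2 + q + 2) * i)) ≤
        Aq F n 4 3 := by
  obtain ⟨C, hC⟩ := exists_isMRD (K := F) (n := n) (by omega)
  obtain ⟨J, X, hJ, hcard, hX3, hXX, hXp⟩ := exists_extra_codewords hq (m := n - 3) (by omega)
  let Y : C ⊕ J → Submodule F ((Fin 3 → F) × (Fin (n - 3) → F)) := Sum.elim
    (fun A ↦ Submodule.span F (Set.range fun i : Fin 3 ↦ ((Pi.single i 1 : Fin 3 → F), A.1 i))) X
  have hY3 : ∀ i, finrank F (Y i) = 3 := by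
    rintro (A | j)
    · exact finrank_span_lift A.1
    · exact hX3 j
  have hYY : ∀ i j, i ≠ j → finrank F (Y i ⊓ Y j : Submodule F _) ≤ 1 := by
    rintro (A | j) (B | j') hne
    · refine finrank_lift_inf_lift_le_one (hC.2 _ (C.sub_mem A.2 B.2) fun h ↦ hne ?_)
      rw [Subtype.ext (sub_eq_zero.1 h)]
    · obtain ⟨p, hp, h⟩ := hXp j'
      exact finrank_lift_inf_le_one A.1 hp h
    · obtain ⟨p, hp, h⟩ := hXp j
      rw [inf_comm]
      exact finrank_lift_inf_le_one B.1 hp h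
    · exact hXX j j' fun h ↦ hne (by rw [h])
  have hinj := concatThree_injective F (n := n) (by omega)
  let Z : C ⊕ J → Submodule F (Fin n → F) := fun i ↦ (Y i).map (concatThree F n)
  have hZ3 : ∀ i, finrank F (Z i) = 3 := fun i ↦ by
    rw [← hY3 i]
    exact (Submodule.equivMapOfInjective _ hinj _).finrank_eq.symm
  have hZZ : ∀ i j, i ≠ j → finrank F (Z i ⊓ Z j : Submodule F _) ≤ 1 := fun i j hij ↦ by
    rw [← Submodule.map_inf _ hinj]
    exact (Submodule.finrank_map_le _ _).trans (hYY i j hij)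
  have hZinj : Function.Injective Z := fun i j hij ↦ by
    by_contra hne
    have := hZZ i j hne
    rw [← hij, inf_idem, hZ3] at this
    omega
  have hncard : (Set.range Z).ncard = q ^ (2 * (n - 3)) +
      ∑ i ∈ Finset.Icc 1 ((n - 3) / (q ^ 2 + q + 2)),
        gaussNat F (q ^ 2 + q + 2) 2 * q ^ (2 * (n - 3 - (q ^ 2 + q + 2) * i)) := by
    rw [← Set.image_univ, Set.ncard_image_of_injective _ hZinj, Set.ncard_univ, Nat.card_sum,
      hcard, Module.natCard_eq_pow_finrank (K := F), hC.1, Nat.card_eq_fintype_card, hq,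
      mul_comm (n - 3)]
  have hS3 : ∀ X ∈ Set.range Z, finrank F X = 3 := by
    rintro _ ⟨i, rfl⟩
    exact hZ3 i
  have hSd : ∀ X ∈ Set.range Z, ∀ Y ∈ Set.range Z, X ≠ Y → 4 ≤ subDist F X Y := by
    rintro _ ⟨i, rfl⟩ _ ⟨j, rfl⟩ hne
    have := hZZ i j fun h ↦ hne (by rw [h])
    rw [subDist, hZ3, hZ3]
    omega
  refine ⟨C, Set.range Z, hC, ?_, Set.toFinite _, hncard, hS3, hSd, hncard ▸ ncard_le_Aq hS3 hSd⟩
  rintro _ ⟨A, hA, rfl⟩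
  exact ⟨Sum.inl ⟨A, hA⟩, (liftSubspace_eq_map A).symm⟩
end

section
/- Let q be a prime power, let n, k, δ be integers with 1 < k ≤ n−k and 1 ≤ δ ≤ k−1, let C^MRD be an (n,k,δ)_q lifted MRD code, and let H be its point–block incidence matrix (rows indexed by the q^{(n−k)(k−δ+1)} codewords, columns indexed by the (q^k−1)q^{n−k}/(q−1) points of V^n). Then the matrix HᵀH, viewed over the rationals (or reals), has exactly three eigenvalues: q^{(n−k)(k−δ)}·(q^k−1)/(q−1) with multiplicity 1, q^{(n−k)(k−δ)} with multiplicity ((q^k−1)/(q−1))·(q^{n−k}−1), and 0 with multiplicity (q^k−1)/(q−1) − 1; equivalently its characteristic polynomial is (X − q^{(n−k)(k−δ)}(q^k−1)/(q−1)) · (X − q^{(n−k)(k−δ)})^{((q^k−1)/(q−1))(q^{n−k}−1)} · X^{(q^k−1)/(q−1) − 1}. -/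
open Module Polynomial Matrix

variable (F : Type) [Field F] [Fintype F]

noncomputable instance (n k : ℕ) : Fintype {P : Submodule F (Fin n → F) // P ∈ Vset F n k} :=
  Fintype.ofFinite _

noncomputable instance (n k : ℕ) (C : Submodule F (Matrix (Fin k) (Fin (n - k)) F)) :
    Fintype {X : Submodule F (Fin n → F) // X ∈ liftedCode F n k C} :=
  Fintype.ofFinite _

noncomputable instance (n k : ℕ) : DecidableEq {P : Submodule F (Fin n → F) // P ∈ Vset F n k} :=
  Classical.decEq _

open scoped Classical in
/-- The point–block incidence matrix `H` of a lifted MRD code: rows are indexed by the codewords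
`X` of the lifted code, columns by the points `P ∈ V^n`, and `H_{X,P} = 1` iff `P ⊆ X`;
entries taken in a commutative ring `R`. -/
noncomputable def incidence (R : Type) [CommRing R] (n k : ℕ)
    (C : Submodule F (Matrix (Fin k) (Fin (n - k)) F)) :
    Matrix {X : Submodule F (Fin n → F) // X ∈ liftedCode F n k C}
           {P : Submodule F (Fin n → F) // P ∈ Vset F n k} R :=
  Matrix.of fun X P =>
    if (P : Submodule F (Fin n → F)) ≤ (X : Submodule F (Fin n → F)) then 1 else 0

/-- A linearly independent family can be prolonged to any length up to the dimension. -/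
theorem LinearIndependent.exists_prolongation {K V : Type*} [Field K] [AddCommGroup V]
    [Module K V] {r : ℕ} {w : Fin r → V} (hw : LinearIndependent K w) {s : ℕ} (hrs : r ≤ s)
    (hs : s ≤ finrank K V) :
    ∃ v : Fin s → V, LinearIndependent K v ∧ ∀ i, v (Fin.castLE hrs i) = w i := by
  induction s, hrs using Nat.le_induction with
  | base => exact ⟨w, hw, fun i => rfl⟩
  | succ s hrs ih =>
    obtain ⟨v, hv, hvw⟩ := ih (by omega)
    obtain ⟨x, hx⟩ := exists_linearIndependent_snoc_of_lt_finrank hv (by omega)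
    refine ⟨_, hx, fun i => ?_⟩
    rw [← hvw i]
    exact Fin.snoc_castSucc (α := fun _ => V) x v (Fin.castLE hrs i)

section

variable {F}

/-- Every fibre of a surjective linear map has the cardinality of the kernel. -/
theorem LinearMap.natCard_fiber_of_surjective {V W : Type*} [AddCommGroup V] [AddCommGroup W]
    [Module F V] [Module F W] [FiniteDimensional F V] (f : V →ₗ[F] W)
    (hf : Function.Surjective f) (w : W) :
    Nat.card {v // f v = w} = Fintype.card F ^ (finrank F V - finrank F W) := by
  obtain ⟨v₀, rfl⟩ := hf w
  let e : {v // f v = f v₀} ≃ LinearMap.ker f :=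
    { toFun := fun v => ⟨v - v₀, by simp [v.2]⟩
      invFun := fun v => ⟨v + v₀, by simp⟩
      left_inv := fun v => by simp
      right_inv := fun v => by simp }
  have h := f.finrank_range_add_finrank_ker
  rw [LinearMap.range_eq_top.mpr hf, finrank_top] at h
  rw [Nat.card_congr e, Module.natCard_eq_pow_finrank (K := F), Nat.card_eq_fintype_card]
  congr 1
  omega

omit [Fintype F] in
theorem Matrix.rank_add_le_of_vecMul_eq_zero {k m s : ℕ} {A : Matrix (Fin k) (Fin m) F}
    {v : Fin s → Fin k → F} (hv : LinearIndependent F v) (hA : ∀ i, v i ᵥ* A = 0) :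
    A.rank + s ≤ k := by
  have h := A.vecMulLinear.finrank_range_add_finrank_ker
  have hr : finrank F (LinearMap.range A.vecMulLinear) = A.rank := by
    rw [_root_.range_vecMulLinear, Matrix.rank_eq_finrank_span_row]
  have hle : Submodule.span F (Set.range v) ≤ LinearMap.ker A.vecMulLinear := by
    rw [Submodule.span_le]
    rintro _ ⟨i, rfl⟩
    simpa using hA i
  have := Submodule.finrank_mono hle
  rw [finrank_span_eq_card hv, Fintype.card_fin] at this
  rw [finrank_fin_fun] at h
  omega

/-- The linear map sending a matrix `A` of the code to the tuple of products `w i * A`. -/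
def vecMulTuple {k m r : ℕ} (C : Submodule F (Matrix (Fin k) (Fin m) F))
    (w : Fin r → Fin k → F) : C →ₗ[F] (Fin r → Fin m → F) where
  toFun A i := w i ᵥ* (A : Matrix (Fin k) (Fin m) F)
  map_add' A B := by
    ext1 i
    simp [Matrix.vecMul_add]
  map_smul' c A := by
    ext1 i
    simp [Matrix.vecMul_smul]

namespace IsMRD

variable {n k δ : ℕ} {C : Submodule F (Matrix (Fin k) (Fin (n - k)) F)}

omit [Fintype F] in
theorem vecMulTuple_surjective (hC : IsMRD F n k δ C) (hδ : 1 ≤ δ) (hδk : δ ≤ k) {r : ℕ}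
    {w : Fin r → Fin k → F} (hw : LinearIndependent F w) (hr : r ≤ k - δ + 1) :
    Function.Surjective (vecMulTuple C w) := by
  obtain ⟨v, hv, hvw⟩ := hw.exists_prolongation hr (by rw [finrank_fin_fun]; omega)
  have hinj : Function.Injective (vecMulTuple C v) := by
    rw [← LinearMap.ker_eq_bot, LinearMap.ker_eq_bot']
    intro A hA
    by_contra hne
    have h1 := hC.2 A A.2 (by simpa using hne)
    have h2 := Matrix.rank_add_le_of_vecMul_eq_zero hv (fun i => congrFun hA i)
    omega
  have hsurj : Function.Surjective (vecMulTuple C v) := by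
    refine (LinearMap.injective_iff_surjective_of_finrank_eq_finrank ?_).mp hinj
    rw [hC.1, Module.finrank_pi_fintype]
    simp [mul_comm]
  intro y
  obtain ⟨A, hA⟩ := hsurj fun i => if h : (i : ℕ) < r then y ⟨i, h⟩ else 0
  refine ⟨A, funext fun i => ?_⟩
  have := congrFun hA (Fin.castLE hr i)
  simpa [vecMulTuple, hvw] using this

/-- An MRD code has constant strength: prescribing the products with few linearly independent
row vectors always leaves the same number of codewords. -/
theorem natCard_vecMul_eq (hC : IsMRD F n k δ C) (hδ : 1 ≤ δ) (hδk : δ ≤ k) {r : ℕ}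
    {w : Fin r → Fin k → F} (hw : LinearIndependent F w) (hr : r ≤ k - δ + 1)
    (y : Fin r → Fin (n - k) → F) :
    Nat.card {A : C // ∀ i, w i ᵥ* (A : Matrix (Fin k) (Fin (n - k)) F) = y i} =
      Fintype.card F ^ ((n - k) * (k - δ + 1 - r)) := by
  have h := (vecMulTuple C w).natCard_fiber_of_surjective
    (hC.vecMulTuple_surjective hδ hδk hw hr) y
  rw [hC.1, Module.finrank_pi_fintype] at h
  simp only [finrank_fin_fun, Finset.sum_const, Finset.card_univ, Fintype.card_fin,
    smul_eq_mul] at h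
  rw [Nat.mul_sub, mul_comm (n - k) r, ← h]
  exact Nat.card_congr (Equiv.subtypeEquivRight fun A => funext_iff.symm)

end IsMRD

end

/-- The characteristic polynomial of the concurrence matrix of a transversal design whose groups
are the fibres of `f`. -/
theorem Matrix.charpoly_of_fibers {P ι : Type*} [Fintype P] [DecidableEq P] [Fintype ι]
    [DecidableEq ι] [Nonempty ι] (f : P → ι) (m : ℕ) (hm : 1 ≤ m)
    (hf : ∀ i, Fintype.card {p // f p = i} = m) (b : ℚ) :
    (Matrix.of fun p p' : P => if p = p' then m * b else if f p = f p' then 0 else b).charpoly =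
      (X - Polynomial.C (m * b * Fintype.card ι)) *
      (X - Polynomial.C (m * b)) ^ (Fintype.card ι * (m - 1)) * X ^ (Fintype.card ι - 1) := by
  set N := Fintype.card ι with hN
  have hN1 : 1 ≤ N := Fintype.card_pos
  have hP : Fintype.card P = N * m := by
    rw [← Fintype.card_congr (Equiv.sigmaFiberEquiv f), Fintype.card_sigma]
    simp [hf, hN]
  let U : Matrix P ι ℚ := Matrix.of fun p i => if f p = i then 1 else 0
  let K : Matrix ι P ℚ := Matrix.of fun i p => if f p = i then 0 else b
  have hUK : (Matrix.of fun p p' : P => if p = p' then m * b else if f p = f p' then 0 else b) =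
      U * K - scalar P (-(m * b)) := by
    have hmul (p p' : P) : (U * K) p p' = if f p = f p' then 0 else b := by
      rw [Matrix.mul_apply, Finset.sum_eq_single (f p)]
      · simp [U, K, eq_comm]
      · intro i _ hi
        simp [U, hi.symm]
      · simp
    ext p p'
    rw [Matrix.sub_apply, hmul]
    by_cases h : p = p'
    · subst h
      simp
    · simp [h]
  have hKU : K * U = vecMulVec (fun _ => m * b) (fun _ => 1) - scalar ι (m * b) := by
    ext i j
    have hs : (∑ p, if f p = j then (1 : ℚ) else 0) = m := by
      rw [Finset.sum_boole, ← Fintype.card_subtype, hf]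
    have : (K * U) i j = ∑ p, (if i = j then 0 else b) * (if f p = j then (1 : ℚ) else 0) := by
      rw [Matrix.mul_apply]
      refine Finset.sum_congr rfl fun p _ => ?_
      by_cases hp : f p = j
      · simp [U, K, hp, eq_comm]
      · simp [U, hp]
    rw [this, ← Finset.mul_sum, hs]
    by_cases h : i = j
    · subst h
      simp [vecMulVec_apply]
    · simp [vecMulVec_apply, h, mul_comm]
  have hle : Fintype.card ι ≤ Fintype.card P := by
    rw [hP]
    exact Nat.le_mul_of_pos_right _ hm
  rw [hUK, charpoly_sub_scalar, charpoly_mul_comm_of_le _ _ hle, hKU, charpoly_sub_scalar,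
    charpoly_vecMulVec, hP, ← hN]
  obtain ⟨M, rfl⟩ := Nat.exists_eq_add_of_le' hm
  obtain ⟨L, hL⟩ := Nat.exists_eq_add_of_le' hN1
  have hexp : (L + 1) * (M + 1) - (L + 1) = (L + 1) * M := by
    rw [Nat.mul_succ, Nat.add_sub_cancel]
  rw [hL, hexp]
  simp [dotProduct, ← hN, hL, smul_eq_C_mul]
  ring

section

variable {F} {n k : ℕ}

/-- The last `n - k` coordinates of a vector. -/
def lastCoords (n k : ℕ) (v : Fin n → F) : Fin (n - k) → F :=
  fun j => v ⟨k + j, by have := j.isLt; omega⟩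

/-- The concatenation of two vectors, as a vector of length `n`. -/
def concatCoords (x : Fin k → F) (y : Fin (n - k) → F) : Fin n → F :=
  fun j => if h : (j : ℕ) < k then x ⟨j, h⟩ else y ⟨(j : ℕ) - k, by have := j.isLt; omega⟩

omit [Fintype F] in
theorem projK_concatCoords (hkn : k ≤ n) (x : Fin k → F) (y : Fin (n - k) → F) :
    projK F n k (concatCoords x y) = x := by
  ext i
  have hi := i.isLt
  simp [projK, concatCoords, show (i : ℕ) < n by omega]

omit [Field F] [Fintype F] in
theorem lastCoords_concatCoords (x : Fin k → F) (y : Fin (n - k) → F) :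
    lastCoords n k (concatCoords x y) = y := by
  ext j
  simp [lastCoords, concatCoords]

omit [Fintype F] in
theorem concatCoords_projK_lastCoords (v : Fin n → F) :
    concatCoords (projK F n k v) (lastCoords n k v) = v := by
  ext j
  by_cases h : (j : ℕ) < k
  · simp [concatCoords, projK, h]
  · simp [concatCoords, lastCoords, h, Nat.add_sub_cancel' (not_lt.mp h)]

omit [Fintype F] in
theorem projK_smul (c : F) (v : Fin n → F) : projK F n k (c • v) = c • projK F n k v := by
  ext i
  by_cases h : (i : ℕ) < n <;> simp [projK, h]

omit [Fintype F] in
theorem lastCoords_smul (c : F) (v : Fin n → F) :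
    lastCoords n k (c • v) = c • lastCoords n k v := rfl

omit [Fintype F] in
theorem eq_of_projK_eq_of_lastCoords_eq {v w : Fin n → F} (h₁ : projK F n k v = projK F n k w)
    (h₂ : lastCoords n k v = lastCoords n k w) : v = w := by
  rw [← concatCoords_projK_lastCoords (k := k) v, h₁, h₂, concatCoords_projK_lastCoords]

omit [Fintype F] in
theorem vecMul_liftMatrix (A : Matrix (Fin k) (Fin (n - k)) F) (c : Fin k → F) :
    c ᵥ* liftMatrix F n k A = concatCoords c (c ᵥ* A) := by
  ext j
  by_cases h : (j : ℕ) < k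
  · have (i : Fin k) : (i : ℕ) = (j : ℕ) ↔ i = ⟨j, h⟩ := by rw [Fin.ext_iff]
    simp [Matrix.vecMul, dotProduct, liftMatrix, concatCoords, h, this]
  · simp [Matrix.vecMul, dotProduct, liftMatrix, concatCoords, h]

omit [Fintype F] in
theorem mem_liftSubspace_iff (hkn : k ≤ n) (A : Matrix (Fin k) (Fin (n - k)) F)
    (v : Fin n → F) :
    v ∈ liftSubspace F n k A ↔ projK F n k v ᵥ* A = lastCoords n k v := by
  have : liftSubspace F n k A = LinearMap.range (liftMatrix F n k A).vecMulLinear :=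
    (range_vecMulLinear _).symm
  simp only [this, LinearMap.mem_range, Matrix.vecMulLinear_apply, vecMul_liftMatrix]
  constructor
  · rintro ⟨c, rfl⟩
    rw [projK_concatCoords hkn, lastCoords_concatCoords]
  · intro h
    exact ⟨projK F n k v, by rw [h, concatCoords_projK_lastCoords]⟩

omit [Fintype F] in
theorem liftSubspace_injective (hkn : k ≤ n) : Function.Injective (liftSubspace F n k) := by
  intro A B h
  ext1 i j
  have hA : concatCoords (Pi.single i 1) (A i) ∈ liftSubspace F n k A := by
    rw [mem_liftSubspace_iff hkn, projK_concatCoords hkn, lastCoords_concatCoords]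
    exact Matrix.single_one_vecMul i A
  rw [h, mem_liftSubspace_iff hkn, projK_concatCoords hkn, lastCoords_concatCoords] at hA
  rw [← hA, Matrix.single_one_vecMul]
  rfl

/-- Codewords of a rank-metric code correspond to codewords of the lifted code. -/
noncomputable def liftEquiv (hkn : k ≤ n) (C : Submodule F (Matrix (Fin k) (Fin (n - k)) F)) :
    C ≃ {X : Submodule F (Fin n → F) // X ∈ liftedCode F n k C} :=
  Equiv.ofBijective (fun A => ⟨liftSubspace F n k A, A, A.2, rfl⟩)
    ⟨fun _ _ h => Subtype.ext (liftSubspace_injective hkn (congrArg Subtype.val h)),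
      fun ⟨_, A, hA, hX⟩ => ⟨⟨A, hA⟩, Subtype.ext hX.symm⟩⟩

omit [Fintype F] in
theorem coe_liftEquiv (hkn : k ≤ n) (C : Submodule F (Matrix (Fin k) (Fin (n - k)) F)) (A : C) :
    (liftEquiv hkn C A : Submodule F (Fin n → F)) = liftSubspace F n k A := rfl

omit [Fintype F] in
theorem mem_Vset_iff (hkn : k ≤ n) (P : Submodule F (Fin n → F)) :
    P ∈ Vset F n k ↔ ∃ v, projK F n k v ≠ 0 ∧ P = Submodule.span F {v} := by
  have (v : Fin n → F) : v ∈ Lset F n k ↔ projK F n k v ≠ 0 := by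
    rw [Function.ne_iff]
    constructor
    · rintro ⟨i, hi, hv⟩
      exact ⟨⟨i, hi⟩, by simpa [projK] using hv⟩
    · rintro ⟨i, hi⟩
      have := i.isLt
      exact ⟨⟨i, by omega⟩, this, by simpa [projK, show (i : ℕ) < n by omega] using hi⟩
  simp only [Vset, Set.mem_ofPred_eq, this]

theorem incidence_transpose_mul_apply (hkn : k ≤ n)
    (C : Submodule F (Matrix (Fin k) (Fin (n - k)) F))
    (P P' : {P : Submodule F (Fin n → F) // P ∈ Vset F n k}) {v v' : Fin n → F}
    (hP : P.1 = Submodule.span F {v}) (hP' : P'.1 = Submodule.span F {v'}) :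
    ((incidence F ℚ n k C)ᵀ * incidence F ℚ n k C) P P' =
      Nat.card {A : C // projK F n k v ᵥ* (A : Matrix (Fin k) (Fin (n - k)) F) =
        lastCoords n k v ∧ projK F n k v' ᵥ* (A : Matrix (Fin k) (Fin (n - k)) F) =
        lastCoords n k v'} := by
  classical
  have := Fintype.ofFinite C
  rw [Matrix.mul_apply, ← (liftEquiv hkn C).sum_comp, Nat.card_eq_fintype_card,
    Fintype.card_subtype, ← Finset.sum_boole]
  refine Finset.sum_congr rfl fun A _ => ?_
  simp only [incidence, Matrix.transpose_apply, Matrix.of_apply, coe_liftEquiv,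
    hP, hP', Submodule.span_singleton_le_iff_mem, mem_liftSubspace_iff hkn]
  split_ifs <;> simp_all

/-- The point of projective space obtained by projecting a point of `V^n`. -/
noncomputable def pointClass (hkn : k ≤ n) (P : {P : Submodule F (Fin n → F) // P ∈ Vset F n k}) :
    Projectivization F (Fin k → F) :=
  Projectivization.mk F (projK F n k ((mem_Vset_iff hkn P.1).mp P.2).choose)
    ((mem_Vset_iff hkn P.1).mp P.2).choose_spec.1

omit [Fintype F] in
theorem pointClass_eq_mk (hkn : k ≤ n) {P : {P : Submodule F (Fin n → F) // P ∈ Vset F n k}}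
    {v : Fin n → F} (hv : projK F n k v ≠ 0) (hP : P.1 = Submodule.span F {v}) :
    pointClass hkn P = Projectivization.mk F (projK F n k v) hv := by
  have h := hP.symm.trans ((mem_Vset_iff hkn P.1).mp P.2).choose_spec.2
  rw [Submodule.span_singleton_eq_span_singleton] at h
  obtain ⟨z, hz⟩ := h
  rw [pointClass, Projectivization.mk_eq_mk_iff']
  exact ⟨z, by rw [← projK_smul]; exact congrArg _ hz⟩

theorem natCard_pointClass_fiber (hkn : k ≤ n) (p : Projectivization F (Fin k → F)) :
    Nat.card {P : {P : Submodule F (Fin n → F) // P ∈ Vset F n k} // pointClass hkn P = p} =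
      Fintype.card F ^ (n - k) := by
  have hproj (y : Fin (n - k) → F) : projK F n k (concatCoords p.rep y) ≠ 0 := by
    rw [projK_concatCoords hkn]
    exact p.rep_nonzero
  have hclass (y : Fin (n - k) → F) : pointClass hkn ⟨Submodule.span F {concatCoords p.rep y},
      (mem_Vset_iff hkn _).mpr ⟨_, hproj y, rfl⟩⟩ = p := by
    rw [pointClass_eq_mk hkn (hproj y) rfl]
    simp only [projK_concatCoords hkn, Projectivization.mk_rep]
  have hcard : Nat.card (Fin (n - k) → F) = Fintype.card F ^ (n - k) := by simp
  rw [← hcard]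
  refine (Nat.card_congr (Equiv.ofBijective
    (fun y => ⟨⟨Submodule.span F {concatCoords p.rep y},
      (mem_Vset_iff hkn _).mpr ⟨_, hproj y, rfl⟩⟩, hclass y⟩) ⟨?_, ?_⟩)).symm
  · intro y y' h
    simp only [Subtype.mk.injEq, Submodule.span_singleton_eq_span_singleton] at h
    obtain ⟨z, hz⟩ := h
    rw [Units.smul_def] at hz
    have h1 := congrArg (projK F n k) hz
    have h2 := congrArg (lastCoords n k) hz
    rw [projK_smul, projK_concatCoords hkn, projK_concatCoords hkn] at h1
    rw [lastCoords_smul, lastCoords_concatCoords, lastCoords_concatCoords] at h2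
    have hz1 : (z : F) = 1 := by
      have : ((z : F) - 1) • p.rep = 0 := by rw [sub_smul, h1, one_smul, sub_self]
      exact sub_eq_zero.mp ((smul_eq_zero.mp this).resolve_right p.rep_nonzero)
    rw [← h2, hz1, one_smul]
  · rintro ⟨⟨P, hPV⟩, hPp⟩
    obtain ⟨v, hv, rfl⟩ := (mem_Vset_iff hkn P).mp hPV
    rw [pointClass_eq_mk hkn hv rfl] at hPp
    obtain ⟨a, ha⟩ := Projectivization.exists_smul_eq_mk_rep F _ hv
    rw [hPp, Units.smul_def] at ha
    refine ⟨lastCoords n k ((a : F) • v), Subtype.ext (Subtype.ext ?_)⟩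
    change Submodule.span F {concatCoords p.rep (lastCoords n k ((a : F) • v))} = _
    rw [← ha, ← projK_smul, concatCoords_projK_lastCoords]
    exact Submodule.span_singleton_group_smul_eq F a v

theorem IsMRD.incidence_transpose_mul_eq {δ : ℕ}
    {C : Submodule F (Matrix (Fin k) (Fin (n - k)) F)} (hC : IsMRD F n k δ C) (hkn : k ≤ n)
    (hδ : 1 ≤ δ) (hδk : δ + 1 ≤ k) [DecidableEq (Projectivization F (Fin k → F))] :
    (incidence F ℚ n k C)ᵀ * incidence F ℚ n k C =
      Matrix.of fun P P' => if P = P' then ((Fintype.card F ^ (n - k) : ℕ) : ℚ) *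
          (Fintype.card F : ℚ) ^ ((n - k) * (k - δ - 1))
        else if pointClass hkn P = pointClass hkn P' then 0
        else (Fintype.card F : ℚ) ^ ((n - k) * (k - δ - 1)) := by
  ext P P'
  obtain ⟨v, hv, hP⟩ := (mem_Vset_iff hkn P.1).mp P.2
  obtain ⟨v', hv', hP'⟩ := (mem_Vset_iff hkn P'.1).mp P'.2
  rw [Matrix.of_apply]
  split_ifs with h h'
  · subst h
    have hw : LinearIndependent F ![projK F n k v] := .of_subsingleton 0 hv
    have := hC.natCard_vecMul_eq hδ (by omega) hw (by omega) ![lastCoords n k v]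
    simp only [Fin.forall_fin_one, Matrix.cons_val_zero] at this
    rw [incidence_transpose_mul_apply hkn C P P hP hP]
    simp only [and_self, this]
    push_cast
    rw [← pow_add]
    congr 1
    obtain ⟨e, rfl⟩ := Nat.exists_eq_add_of_le hδk
    rw [show δ + 1 + e - δ = e + 1 by omega, Nat.add_sub_cancel]
    ring
  · rw [incidence_transpose_mul_apply hkn C P P' hP hP']
    rw [pointClass_eq_mk hkn hv hP, pointClass_eq_mk hkn hv' hP',
      Projectivization.mk_eq_mk_iff] at h'
    obtain ⟨a, ha⟩ := h'
    rw [Units.smul_def] at ha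
    rw [Nat.cast_eq_zero, Nat.card_eq_zero]
    refine .inl ⟨fun ⟨A, hA, hA'⟩ => h ?_⟩
    have hva : v = (a : F) • v' := by
      refine eq_of_projK_eq_of_lastCoords_eq (k := k) ?_ ?_
      · rw [projK_smul, ha]
      · rw [lastCoords_smul, ← hA, ← hA', ← ha, Matrix.smul_vecMul]
    refine Subtype.ext ?_
    rw [hP, hP', hva]
    exact Submodule.span_singleton_group_smul_eq F a v'
  · rw [incidence_transpose_mul_apply hkn C P P' hP hP']
    have hw : LinearIndependent F ![projK F n k v, projK F n k v'] := by
      rw [LinearIndependent.pair_iff' hv]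
      intro a ha
      refine h' ?_
      rw [pointClass_eq_mk hkn hv hP, pointClass_eq_mk hkn hv' hP', eq_comm,
        Projectivization.mk_eq_mk_iff']
      exact ⟨a, ha⟩
    have := hC.natCard_vecMul_eq hδ (by omega) hw (by omega)
      ![lastCoords n k v, lastCoords n k v']
    simp only [Fin.forall_fin_two, Matrix.cons_val_zero, Matrix.cons_val_one] at this
    rw [this, show k - δ + 1 - 2 = k - δ - 1 by omega]
    push_cast
    rfl

end

/-- The matrix `HᵀH` of the incidence matrix `H` of an `(n,k,δ)_q` lifted
MRD code, viewed over `ℚ`, has eigenvalues `q^{(n-k)(k-δ)}(q^k-1)/(q-1)` with multiplicity 1,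
`q^{(n-k)(k-δ)}` with multiplicity `((q^k-1)/(q-1))(q^{n-k}-1)`, and `0` with multiplicity
`(q^k-1)/(q-1) - 1`; equivalently, its characteristic polynomial is as below. -/
theorem stmt16 (q n k δ : ℕ) (hq : Fintype.card F = q)
    (hk : 1 < k) (hkn : k ≤ n - k) (hδ1 : 1 ≤ δ) (hδk : δ ≤ k - 1)
    (C : Submodule F (Matrix (Fin k) (Fin (n - k)) F)) (hC : IsMRD F n k δ C) :
    Matrix.charpoly ((incidence F ℚ n k C)ᵀ * incidence F ℚ n k C) =
      (X - Polynomial.C ((q : ℚ) ^ ((n - k) * (k - δ)) * ((q : ℚ) ^ k - 1) / ((q : ℚ) - 1))) *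
      (X - Polynomial.C ((q : ℚ) ^ ((n - k) * (k - δ)))) ^
        (((q ^ k - 1) / (q - 1)) * (q ^ (n - k) - 1)) *
      X ^ ((q ^ k - 1) / (q - 1) - 1) := by
  classical
  have hkn' : k ≤ n := by omega
  have hq1 : 1 < q := hq ▸ Fintype.one_lt_card
  have : Fintype (Projectivization F (Fin k → F)) := Fintype.ofFinite _
  have : Nonempty (Fin k) := ⟨⟨0, by omega⟩⟩
  have : Nonempty (Projectivization F (Fin k → F)) := inferInstance
  have hcard : Fintype.card (Projectivization F (Fin k → F)) = (q ^ k - 1) / (q - 1) := by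
    rw [← @Nat.card_eq_fintype_card (Projectivization F _), Projectivization.card'']
    simp [hq]
  have hcardQ : (Fintype.card (Projectivization F (Fin k → F)) : ℚ) = ((q : ℚ) ^ k - 1) / ((q : ℚ) - 1) := by
    have h := Projectivization.card' F (Fin k → F)
    simp only [Nat.card_eq_fintype_card, Fintype.card_pi, Finset.prod_const, Finset.card_univ,
      Fintype.card_fin, hq] at h
    have hq1' : (q : ℚ) - 1 ≠ 0 := sub_ne_zero.mpr (by exact_mod_cast hq1.ne')
    have h' := congrArg (Nat.cast : ℕ → ℚ) h
    push_cast [Nat.cast_sub hq1.le] at h'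
    rw [eq_div_iff hq1', h', add_sub_cancel_right]
  rw [hC.incidence_transpose_mul_eq hkn' hδ1 (by omega),
    Matrix.charpoly_of_fibers (pointClass hkn') (Fintype.card F ^ (n - k))
      (Nat.one_le_pow _ _ Fintype.card_pos) fun p => ?_, hcardQ, hcard, hq]
  · have hpow : ((q ^ (n - k) : ℕ) : ℚ) * (q : ℚ) ^ ((n - k) * (k - δ - 1)) =
        (q : ℚ) ^ ((n - k) * (k - δ)) := by
      push_cast
      rw [← pow_add]
      congr 1
      obtain ⟨e, he⟩ := Nat.exists_eq_add_of_le' (show 1 ≤ k - δ by omega)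
      rw [he, Nat.add_sub_cancel]
      ring
    rw [hpow, mul_div_assoc]
  · rw [← Nat.card_eq_fintype_card]
    exact natCard_pointClass_fiber hkn' p
end
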